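/- Let n ∈ {2, 3} and let K₁, …, Kₙ be pairwise disjoint, compact, strictly convex subsets of ℝ², each with nonempty interior. Then there exists an ordinary line, i.e. an affine line L in ℝ² such that L ∩ (K₁ ∪ ⋯ ∪ Kₙ) consists of exactly two points. -/

import Mathlib

/-- An affine line: an affine subspace whose direction is one-dimensional. -/
def IsLine {d : ℕ} (L : AffineSubspace ℝ (EuclideanSpace ℝ (Fin d))) : Prop :=
  Module.finrank ℝ L.direction = 1

/-- Weighted averages. -/
lemma avg_le {a x y c : ℝ} (h0 : 0 < a) (h1 : a < 1) (hx : x ≤ c) (hy : y ≤ c) :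
    (1 - a) * x + a * y ≤ c := by nlinarith

lemma avg_eq_left {a x y c : ℝ} (h1 : a < 1) (h0 : 0 < a) (hx : x ≤ c) (hy : y ≤ c)
    (h : c = (1 - a) * x + a * y) : x = c := by nlinarith

lemma avg_eq_right {a x y c : ℝ} (h1 : a < 1) (h0 : 0 < a) (hx : x ≤ c) (hy : y ≤ c)
    (h : c = (1 - a) * x + a * y) : y = c := by nlinarith

abbrev Pl := EuclideanSpace ℝ (Fin 2)

/-- The linear functional in direction `t`. -/
noncomputable def ev (t : ℝ) (x : Pl) : ℝ := Real.cos t * x 0 + Real.sin t * x 1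

/-- The support function. -/
noncomputable def supp (K : Set Pl) (t : ℝ) : ℝ := sSup (ev t '' K)

lemma ev_cont : Continuous (fun z : ℝ × Pl => ev z.1 z.2) := by
  unfold ev; fun_prop

lemma ev_cont' (t : ℝ) : Continuous (ev t) := by
  unfold ev; fun_prop

lemma supp_cont {K : Set Pl} (hK : IsCompact K) : Continuous (supp K) :=
  hK.continuous_sSup ev_cont

lemma supp_le {K : Set Pl} (hK : IsCompact K) (t : ℝ) {x : Pl} (hx : x ∈ K) :
    ev t x ≤ supp K t :=
  le_csSup (hK.image (ev_cont' t)).bddAbove ⟨x, hx, rfl⟩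

lemma supp_att {K : Set Pl} (hK : IsCompact K) (hne : K.Nonempty) (t : ℝ) :
    ∃ x ∈ K, ev t x = supp K t := by
  obtain ⟨x, hx, h⟩ := (hK.image (ev_cont' t)).sSup_mem (hne.image _)
  exact ⟨x, hx, h⟩

lemma ev_comb (t a b : ℝ) (x y : Pl) : ev t (a • x + b • y) = a * ev t x + b * ev t y := by
  simp [ev]; ring

lemma ev_pi (t : ℝ) (x : Pl) : ev (t + Real.pi) x = - ev t x := by
  simp [ev]; ring

lemma exists_gt {K : Set Pl} {x : Pl} (hx : x ∈ interior K) (t : ℝ) :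
    ∃ y ∈ K, ev t x < ev t y := by
  let w : Pl := !₂[Real.cos t, Real.sin t]
  have hc : Continuous (fun s : ℝ => x + s • w) := by fun_prop
  have h0 : ∀ᶠ s in nhds (0:ℝ), x + s • w ∈ K := by
    have : K ∈ nhds (x + (0:ℝ) • w) := by simpa using mem_interior_iff_mem_nhds.1 hx
    exact hc.continuousAt.eventually this
  obtain ⟨e, he, h⟩ := Metric.eventually_nhds_iff.1 h0
  refine ⟨x + (e/2) • w, h ?_, ?_⟩
  · simp [abs_of_pos he]
    exact he
  · have : ev t (x + (e/2) • w) = ev t x + e/2 := by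
      have := Real.cos_sq_add_sin_sq t
      simp [ev, w]; linear_combination (e/2) * this
    linarith

lemma exists_lt' {K : Set Pl} {x : Pl} (hx : x ∈ interior K) (t : ℝ) :
    ∃ y ∈ K, ev t y < ev t x := by
  obtain ⟨y, hy, h⟩ := exists_gt hx (t + Real.pi)
  rw [ev_pi, ev_pi] at h
  exact ⟨y, hy, by linarith⟩

lemma max_uniq {K : Set Pl} (hs : StrictConvex ℝ K) {t c : ℝ} (hc : ∀ x ∈ K, ev t x ≤ c)
    {x y : Pl} (hx : x ∈ K) (hy : y ∈ K) (ex : ev t x = c) (ey : ev t y = c) : x = y := by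
  by_contra hne
  have hm := hs hx hy hne (a := 1/2) (b := 1/2) (by norm_num) (by norm_num) (by norm_num)
  obtain ⟨z, hz, h⟩ := exists_gt hm t
  rw [ev_comb, ex, ey] at h
  have := hc z hz
  linarith

lemma min_uniq {K : Set Pl} (hs : StrictConvex ℝ K) {t c : ℝ} (hc : ∀ x ∈ K, c ≤ ev t x)
    {x y : Pl} (hx : x ∈ K) (hy : y ∈ K) (ex : ev t x = c) (ey : ev t y = c) : x = y := by
  refine max_uniq hs (t := t + Real.pi) (c := -c) ?_ hx hy ?_ ?_
  · intro z hz; rw [ev_pi]; linarith [hc z hz]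
  · rw [ev_pi, ex]
  · rw [ev_pi, ey]

lemma sep {A B : Set Pl} (hA : IsCompact A) (hB : IsCompact B) (cA : Convex ℝ A)
    (cB : Convex ℝ B) (hd : Disjoint A B) (nA : A.Nonempty) (nB : B.Nonempty) :
    ∃ t c, (∀ a ∈ A, ev t a < c) ∧ ∀ b ∈ B, c < ev t b := by
  obtain ⟨f, u, v, h1, h2, h3⟩ := geometric_hahn_banach_compact_closed cA hA cB hB.isClosed hd
  have hf : ∀ x : Pl, f x = f (EuclideanSpace.single 0 1) * x 0
      + f (EuclideanSpace.single 1 1) * x 1 := by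
    intro x
    have : x = x 0 • EuclideanSpace.single 0 (1:ℝ) + x 1 • EuclideanSpace.single 1 (1:ℝ) := by
      ext i; fin_cases i <;> simp
    conv_lhs => rw [this]
    simp; ring
  set z : ℂ := ⟨f (EuclideanSpace.single 0 1), f (EuclideanSpace.single 1 1)⟩ with hz
  have e1 : ‖z‖ * Real.cos z.arg = f (EuclideanSpace.single 0 1) := by
    rw [Complex.norm_mul_cos_arg]
  have e2 : ‖z‖ * Real.sin z.arg = f (EuclideanSpace.single 1 1) := by
    rw [Complex.norm_mul_sin_arg]
  have hf' : ∀ x, f x = ‖z‖ * ev z.arg x := by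
    intro x; rw [hf, ← e1, ← e2]; simp only [ev]; ring
  obtain ⟨a, ha⟩ := nA
  obtain ⟨b, hb⟩ := nB
  have hpos : 0 < ‖z‖ := by
    rcases (norm_nonneg z).lt_or_eq with h | h
    · exact h
    · have ha' := h1 a ha
      have hb' := h3 b hb
      rw [hf', ← h] at ha' hb'
      linarith
  refine ⟨z.arg, u / ‖z‖, fun a ha => ?_, fun b hb => ?_⟩
  · rw [lt_div_iff₀ hpos]
    have := h1 a ha; rw [hf'] at this; linarith
  · rw [div_lt_iff₀ hpos]
    have := h3 b hb; rw [hf'] at this; linarith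

/-- Inner common tangent. -/
lemma inner_tangent {A B : Set Pl} (hA : IsCompact A) (hB : IsCompact B) (cA : Convex ℝ A)
    (cB : Convex ℝ B) (hd : Disjoint A B) (nA : A.Nonempty) (nB : B.Nonempty) :
    ∃ t c, (∀ a ∈ A, ev t a ≤ c) ∧ (∀ b ∈ B, c ≤ ev t b) ∧
      (∃ a ∈ A, ev t a = c) ∧ ∃ b ∈ B, ev t b = c := by
  obtain ⟨t, c, h1, h2⟩ := sep hA hB cA cB hd nA nB
  let g : ℝ → ℝ := fun s => supp A s + supp B (s + Real.pi)
  have gc : Continuous g := by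
    have := supp_cont hA
    have := supp_cont hB
    fun_prop
  have g1 : g t ≤ 0 := by
    obtain ⟨a, ha, ea⟩ := supp_att hA nA t
    obtain ⟨b, hb, eb⟩ := supp_att hB nB (t + Real.pi)
    have := h1 a ha
    have := h2 b hb
    rw [ev_pi] at eb
    simp only [g]; linarith
  have g2 : 0 ≤ g (t + Real.pi) := by
    obtain ⟨a, ha⟩ := nA
    obtain ⟨b, hb⟩ := nB
    have ha' := supp_le hA (t + Real.pi) ha
    have hb' := supp_le hB (t + Real.pi + Real.pi) hb
    rw [ev_pi] at ha'
    rw [ev_pi, ev_pi] at hb'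
    have := h1 a ha
    have := h2 b hb
    simp only [g]; linarith
  obtain ⟨s, hs⟩ := mem_range_of_exists_le_of_exists_ge gc ⟨t, g1⟩ ⟨_, g2⟩
  simp only [g] at hs
  refine ⟨s, supp A s, fun a ha => supp_le hA s ha, fun b hb => ?_, supp_att hA nA s, ?_⟩
  · have := supp_le hB (s + Real.pi) hb
    rw [ev_pi] at this; linarith
  · obtain ⟨b, hb, eb⟩ := supp_att hB nB (s + Real.pi)
    rw [ev_pi] at eb
    exact ⟨b, hb, by linarith⟩

lemma parallel {s t : ℝ} {a b : Pl} (hne : a ≠ b) (h1 : ev s a = ev s b) (h2 : ev t a = ev t b) :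
    (Real.cos s = Real.cos t ∧ Real.sin s = Real.sin t) ∨
    (Real.cos s = -Real.cos t ∧ Real.sin s = -Real.sin t) := by
  have hd : a 0 - b 0 ≠ 0 ∨ a 1 - b 1 ≠ 0 := by
    by_contra h
    push Not at h
    apply hne
    ext i; fin_cases i
    · simpa using sub_eq_zero.1 h.1
    · simpa using sub_eq_zero.1 h.2
  simp only [ev] at h1 h2
  have hdet : Real.cos s * Real.sin t - Real.sin s * Real.cos t = 0 := by
    rcases hd with h | h
    · apply mul_left_cancel₀ h
      linear_combination Real.sin t * h1 - Real.sin s * h2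
    · apply mul_left_cancel₀ h
      linear_combination Real.cos s * h2 - Real.cos t * h1
  have es := Real.cos_sq_add_sin_sq s
  have et := Real.cos_sq_add_sin_sq t
  have hk : (Real.cos s * Real.cos t + Real.sin s * Real.sin t)^2 = 1 := by
    linear_combination (Real.cos t ^2 + Real.sin t^2) * es + et
      - (Real.cos s * Real.sin t - Real.sin s * Real.cos t) * hdet
  have hk' : (Real.cos s * Real.cos t + Real.sin s * Real.sin t - 1) *
      (Real.cos s * Real.cos t + Real.sin s * Real.sin t + 1) = 0 := by linear_combination hk
  rcases mul_eq_zero.1 hk' with h | h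
  · left
    constructor
    · linear_combination Real.cos t * h + Real.sin t * hdet - Real.cos s * et
    · linear_combination Real.sin t * h - Real.cos t * hdet - Real.sin s * et
  · right
    constructor
    · linear_combination Real.cos t * h + Real.sin t * hdet - Real.cos s * et
    · linear_combination Real.sin t * h - Real.cos t * hdet - Real.sin s * et

lemma line_exists (t : ℝ) (p : Pl) : ∃ L : AffineSubspace ℝ Pl,
    Module.finrank ℝ L.direction = 1 ∧ ∀ x, x ∈ L ↔ ev t x = ev t p := by
  let v : Pl := !₂[-Real.sin t, Real.cos t]
  have et := Real.cos_sq_add_sin_sq t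
  have hv : v ≠ 0 := by
    intro h
    have h0 : v 0 = 0 := by rw [h]; rfl
    have h1 : v 1 = 0 := by rw [h]; rfl
    simp [v] at h0 h1
    simp [h0, h1] at et
  refine ⟨AffineSubspace.mk' p (Submodule.span ℝ {v}), ?_, fun x => ?_⟩
  · rw [AffineSubspace.direction_mk']
    exact finrank_span_singleton hv
  · rw [AffineSubspace.mem_mk', Submodule.mem_span_singleton, vsub_eq_sub]
    constructor
    · rintro ⟨a, ha⟩
      have : x = p + a • v := by rw [ha]; abel
      rw [this]; simp [ev, v]; ring
    · intro h
      simp only [ev] at h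
      refine ⟨-Real.sin t * (x 0 - p 0) + Real.cos t * (x 1 - p 1), ?_⟩
      ext i; fin_cases i
      · simp [v]
        linear_combination (x 0 - p 0) * et - Real.cos t * h
      · simp [v]
        linear_combination (x 1 - p 1) * et - Real.sin t * h

set_option maxHeartbeats 1000000 in
/-- The separation core: `K₂` is in the middle along one of two distinct common supporting lines. -/
lemma core {K1 K2 K3 : Set Pl} (hc1 : IsCompact K1) (hc2 : IsCompact K2)
    (s1 : StrictConvex ℝ K1) (s2 : StrictConvex ℝ K2) (s3 : StrictConvex ℝ K3)
    (n1 : (interior K1).Nonempty) (n2 : (interior K2).Nonempty)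
    (d12 : Disjoint K1 K2) (d13 : Disjoint K1 K3) (d23 : Disjoint K2 K3)
    {t t' c c' : ℝ} (hne : ¬ (Real.cos t = Real.cos t' ∧ Real.sin t = Real.sin t'))
    (b1 : ∀ x ∈ K1, ev t x ≤ c) (b2 : ∀ x ∈ K2, ev t x ≤ c) (b3 : ∀ x ∈ K3, ev t x ≤ c)
    (b1' : ∀ x ∈ K1, ev t' x ≤ c') (b2' : ∀ x ∈ K2, ev t' x ≤ c') (b3' : ∀ x ∈ K3, ev t' x ≤ c')
    {p1 p2 p3 q2 : Pl} (hp1 : p1 ∈ K1) (hp2 : p2 ∈ K2) (hp3 : p3 ∈ K3) (hq2 : q2 ∈ K2)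
    (e1 : ev t p1 = c) (e2 : ev t p2 = c) (e3 : ev t p3 = c) (e2' : ev t' q2 = c')
    (hw : Wbtw ℝ p1 p2 p3) :
    ∃ s d, (∀ x ∈ K1, ev s x ≤ d) ∧ (∀ x ∈ K2, d ≤ ev s x) ∧
      (∃ a ∈ K1, ev s a = d) ∧ (∃ a ∈ K2, ev s a = d) ∧ ∀ r ∈ K3, ev s r ≠ d := by
  have const_false : ∀ {K : Set Pl}, (interior K).Nonempty → ∀ t c : ℝ,
      (∀ x ∈ K, ev t x = c) → False := by
    rintro K ⟨x, hx⟩ t c h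
    obtain ⟨y, hy, hxy⟩ := exists_gt hx t
    rw [h y hy, h x (interior_subset hx)] at hxy
    exact lt_irrefl _ hxy
  have n13 : p1 ≠ p3 := fun h => d13.le_bot ⟨hp1, h ▸ hp3⟩
  have n12 : p1 ≠ p2 := fun h => d12.le_bot ⟨hp1, h ▸ hp2⟩
  have n23 : p2 ≠ p3 := fun h => d23.le_bot ⟨hp2, h ▸ hp3⟩
  obtain ⟨l, ⟨hl0, hl1⟩, hl⟩ := hw
  rw [AffineMap.lineMap_apply_module] at hl
  have hl0 : 0 < l := by
    rcases hl0.lt_or_eq with h | h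
    · exact h
    · subst h; simp at hl; exact absurd hl n12
  have hl1 : l < 1 := by
    rcases hl1.lt_or_eq with h | h
    · exact h
    · subst h; simp at hl; exact absurd hl.symm n23
  -- the chord is nondegenerate
  have hpq : p2 ≠ q2 := by
    intro h
    subst h
    have h1 := b1' p1 hp1
    have h3 := b3' p3 hp3
    rw [← hl, ev_comb] at e2'
    have h1' : ev t' p1 = c' := by nlinarith
    have h3' : ev t' p3 = c' := by nlinarith
    rcases parallel n13 (e1.trans e3.symm) (h1'.trans h3'.symm) with h | ⟨h, h'⟩
    · exact hne h
    · have hev : ∀ x, ev t x = - ev t' x := fun x => by simp only [ev, h, h']; ring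
      refine const_false n1 t c fun x hx => le_antisymm (b1 x hx) ?_
      have := b1' x hx
      rw [← e1, hev, hev, h1']; linarith
  have hA : ev t q2 < c := by
    refine lt_of_le_of_ne (b2 _ hq2) fun h => hpq (max_uniq s2 b2 hp2 hq2 e2 h)
  have hB : ev t' p2 < c' := by
    refine lt_of_le_of_ne (b2' _ hp2) fun h => hpq (max_uniq s2 b2' hp2 hq2 h e2')
  let χ : Pl → ℝ := fun x => (q2 0 - p2 0) * (x 1 - p2 1) - (q2 1 - p2 1) * (x 0 - p2 0)
  have χcomb : ∀ (a : ℝ) x y, χ ((1 - a) • x + a • y) = (1 - a) * χ x + a * χ y := by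
    intro a x y; simp [χ]; ring
  have χzero : ∀ x, χ x = 0 → ∃ a : ℝ, x = (1 - a) • p2 + a • q2 := by
    intro x hx
    simp only [χ] at hx
    by_cases h0 : q2 0 - p2 0 = 0
    · have h1 : q2 1 - p2 1 ≠ 0 := by
        intro h1; apply hpq; ext i; fin_cases i
        · simpa using (sub_eq_zero.1 h0).symm
        · simpa using (sub_eq_zero.1 h1).symm
      refine ⟨(x 1 - p2 1) / (q2 1 - p2 1), ?_⟩
      ext i; fin_cases i
      · simp; field_simp; linear_combination -hx
      · simp; field_simp; ring
    · refine ⟨(x 0 - p2 0) / (q2 0 - p2 0), ?_⟩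
      ext i; fin_cases i
      · simp; field_simp; ring
      · simp; field_simp; linear_combination hx
  have chord : ∀ x, ev t x ≤ c → ev t' x ≤ c' → χ x = 0 →
      ∃ a : ℝ, 0 ≤ a ∧ a ≤ 1 ∧ x = (1 - a) • p2 + a • q2 := by
    intro x h h' hx
    obtain ⟨a, rfl⟩ := χzero x hx
    rw [ev_comb, e2] at h
    rw [ev_comb, e2'] at h'
    exact ⟨a, by nlinarith, by nlinarith, rfl⟩
  have chordK : ∀ x, ev t x ≤ c → ev t' x ≤ c' → χ x = 0 → x ∈ K2 := by
    intro x h h' hx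
    obtain ⟨a, h0, h1, rfl⟩ := chord x h h' hx
    exact s2.convex hp2 hq2 (by linarith) h0 (by ring)
  -- sign change lemma
  have cross : ∀ x y, χ x * χ y < 0 → ∃ a : ℝ, 0 < a ∧ a < 1 ∧ χ ((1 - a) • x + a • y) = 0 := by
    intro x y hxy
    have hne : χ x - χ y ≠ 0 := by
      intro h
      rw [sub_eq_zero.1 h] at hxy
      nlinarith [mul_self_nonneg (χ y)]
    have hpos : 0 < (χ x - χ y)^2 := by positivity
    refine ⟨(χ x * (χ x - χ y)) / (χ x - χ y)^2, ?_, ?_, ?_⟩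
    · apply div_pos _ hpos
      nlinarith [mul_self_nonneg (χ x)]
    · rw [div_lt_one hpos]
      nlinarith [mul_self_nonneg (χ y)]
    · rw [χcomb]; field_simp; ring
  have same1 : ∀ x ∈ K1, ∀ y ∈ K1, 0 < χ x * χ y := by
    intro x hx y hy
    by_contra h
    have hz : ∀ z ∈ K1, χ z ≠ 0 := fun z hz h0 =>
      d12.le_bot ⟨hz, chordK z (b1 z hz) (b1' z hz) h0⟩
    have : χ x * χ y < 0 := lt_of_le_of_ne (not_lt.1 h) (mul_ne_zero (hz x hx) (hz y hy))
    obtain ⟨a, h0, h1, h2⟩ := cross x y this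
    exact hz _ (s1.convex hx hy (by linarith) h0.le (by ring)) h2
  have same3 : ∀ x ∈ K3, ∀ y ∈ K3, 0 < χ x * χ y := by
    intro x hx y hy
    by_contra h
    have hz : ∀ z ∈ K3, χ z ≠ 0 := fun z hz h0 =>
      d23.le_bot ⟨chordK z (b3 z hz) (b3' z hz) h0, hz⟩
    have : χ x * χ y < 0 := lt_of_le_of_ne (not_lt.1 h) (mul_ne_zero (hz x hx) (hz y hy))
    obtain ⟨a, h0, h1, h2⟩ := cross x y this
    exact hz _ (s3.convex hx hy (by linarith) h0.le (by ring)) h2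
  have opp : χ p1 * χ p3 < 0 := by
    have h1 := same1 p1 hp1 p1 hp1
    have h : (1 - l) * χ p1 + l * χ p3 = 0 := by
      rw [← χcomb, hl]; simp [χ]
    have : l * (χ p1 * χ p3) = - ((1 - l) * (χ p1 * χ p1)) := by linear_combination χ p1 * h
    have h2 : 0 < (1 - l) * (χ p1 * χ p1) := mul_pos (by linarith) h1
    by_contra h3
    have := mul_nonneg hl0.le (not_lt.1 h3)
    linarith
  obtain ⟨s, d, f1, f2, ⟨a1, ha1, g1⟩, ⟨a2, ha2, g2⟩⟩ := inner_tangent hc1 hc2 s1.convex s2.convex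
    d12 ⟨p1, hp1⟩ ⟨p2, hp2⟩
  refine ⟨s, d, f1, f2, ⟨a1, ha1, g1⟩, ⟨a2, ha2, g2⟩, fun r hr er => ?_⟩
  have nar : a1 ≠ r := fun h => d13.le_bot ⟨ha1, h ▸ hr⟩
  have hneg : χ a1 * χ r < 0 := by
    have h1 := same1 a1 ha1 p1 hp1
    have h3 := same3 p3 hp3 r hr
    by_contra h
    have h5 := mul_pos h1 h3
    have h4 := mul_nonneg (not_lt.1 h) (neg_pos.2 opp).le
    have h6 : (χ a1 * χ p1) * (χ p3 * χ r) = - ((χ a1 * χ r) * -(χ p1 * χ p3)) := by ring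
    linarith
  obtain ⟨a, h0, h1, hm⟩ := cross a1 r hneg
  set m := (1 - a) • a1 + a • r with hmdef
  have mt : ev t m = (1 - a) * ev t a1 + a * ev t r := ev_comb _ _ _ _ _
  have mt' : ev t' m = (1 - a) * ev t' a1 + a * ev t' r := ev_comb _ _ _ _ _
  have ms : ev s m = d := by rw [hmdef, ev_comb, g1, er]; ring
  have u1 := b1 a1 ha1
  have u1' := b1' a1 ha1
  have u3 := b3 r hr
  have u3' := b3' r hr
  obtain ⟨k, k0, k1, hk⟩ := chord m (by rw [mt]; exact avg_le h0 h1 u1 u3)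
    (by rw [mt']; exact avg_le h0 h1 u1' u3') hm
  have fin : ∀ t c, (∀ x ∈ K1, ev t x ≤ c) → (∀ x ∈ K2, ev t x ≤ c) → ev t a1 = c → ev t r = c →
      False := by
    intro t c b1 b2 e1 e3
    rcases parallel nar (g1.trans er.symm) (e1.trans e3.symm) with ⟨h, h'⟩ | ⟨h, h'⟩
    · have hev : ∀ x, ev s x = ev t x := fun x => by simp only [ev, h, h']
      refine const_false n2 t c fun x hx => le_antisymm (b2 x hx) ?_
      have := f2 x hx
      rw [hev] at this g1; linarith
    · have hev : ∀ x, ev s x = - ev t x := fun x => by simp only [ev, h, h']; ring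
      refine const_false n1 t c fun x hx => le_antisymm (b1 x hx) ?_
      have := f1 x hx
      rw [hev] at this g1; linarith
  rcases k0.lt_or_eq with k0 | k0
  · rcases k1.lt_or_eq with k1 | k1
    · have hi := s2 hp2 hq2 hpq (a := 1 - k) (b := k) (by linarith) k0 (by ring)
      rw [← hk] at hi
      obtain ⟨y, hy, hlt⟩ := exists_lt' hi s
      have := f2 y hy
      linarith
    · subst k1
      simp at hk
      rw [hk, e2'] at mt'
      exact fin t' c' b1' b2' (avg_eq_left h1 h0 u1' u3' mt') (avg_eq_right h1 h0 u1' u3' mt')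
  · subst k0
    simp at hk
    rw [hk, e2] at mt
    exact fin t c b1 b2 (avg_eq_left h1 h0 u1 u3 mt) (avg_eq_right h1 h0 u1 u3 mt)

lemma mk_line {n : ℕ} (K : Fin n → Set Pl) {i j : Fin n} (hd : Disjoint (K i) (K j)) {s d : ℝ}
    {a b : Pl} (ha : a ∈ K i) (hb : b ∈ K j) (ea : ev s a = d) (eb : ev s b = d)
    (ua : ∀ x ∈ K i, ev s x = d → x = a) (ub : ∀ x ∈ K j, ev s x = d → x = b)
    (ho : ∀ k, k ≠ i → k ≠ j → ∀ x ∈ K k, ev s x ≠ d) :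
    ∃ L : AffineSubspace ℝ Pl, Module.finrank ℝ L.direction = 1 ∧
      ∃ p q, p ≠ q ∧ (L : Set Pl) ∩ (⋃ i, K i) = {p, q} := by
  obtain ⟨L, hL, hm⟩ := line_exists s a
  refine ⟨L, hL, a, b, fun h => hd.le_bot ⟨ha, h ▸ hb⟩, ?_⟩
  ext x
  simp only [Set.mem_inter_iff, SetLike.mem_coe, hm, Set.mem_iUnion, Set.mem_insert_iff,
    Set.mem_singleton_iff, ea]
  constructor
  · rintro ⟨hx, k, hk⟩
    by_cases h1 : k = i
    · subst h1; exact Or.inl (ua x hk hx)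
    · by_cases h2 : k = j
      · subst h2; exact Or.inr (ub x hk hx)
      · exact absurd hx (ho k h1 h2 x hk)
  · rintro (rfl | rfl)
    · exact ⟨ea, i, ha⟩
    · exact ⟨eb, j, hb⟩

lemma not_dominated {A B : Set Pl} (hA : IsCompact A) (hB : IsCompact B) (cA : Convex ℝ A)
    (hd : Disjoint A B) (nA : A.Nonempty) (nB : B.Nonempty) :
    ∃ t, supp A t < supp B t := by
  obtain ⟨b, hb⟩ := nB
  obtain ⟨t, c, h1, h2⟩ := sep hA isCompact_singleton cA (convex_singleton b)
    (hd.mono_right (Set.singleton_subset_iff.2 hb)) nA ⟨b, rfl⟩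
  obtain ⟨a, ha, ea⟩ := supp_att hA nA t
  exact ⟨t, by linarith [h1 a ha, h2 b rfl, supp_le hB t hb]⟩

lemma supp_period (K : Set Pl) : Function.Periodic (supp K) (2 * Real.pi) := by
  intro t
  have : ev (t + 2 * Real.pi) = ev t := by funext x; simp [ev]
  simp [supp, this]

lemma tie (K : Fin 3 → Set Pl) (hdisj : Pairwise fun i j => Disjoint (K i) (K j))
    (hcpt : ∀ i, IsCompact (K i)) (hcv : ∀ i, Convex ℝ (K i)) (hne : ∀ i, (K i).Nonempty) (t0 : ℝ) :
    ∃ t ∈ Set.Ioo t0 (t0 + 2 * Real.pi), ∃ i j, i ≠ j ∧ supp (K i) t = supp (K j) t ∧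
      ∀ k, supp (K k) t ≤ supp (K i) t := by
  have hpi := Real.pi_pos
  obtain ⟨i, hi⟩ := Finite.exists_max (fun i => supp (K i) (t0 + Real.pi))
  have hij : i ≠ i + 1 := by fin_cases i <;> decide
  have hik : i ≠ i + 2 := by fin_cases i <;> decide
  have hall : ∀ k, k = i ∨ k = i + 1 ∨ k = i + 2 := by fin_cases i <;> decide
  let F : ℝ → ℝ := fun t => supp (K i) t - max (supp (K (i+1)) t) (supp (K (i+2)) t)
  have Fc : Continuous F :=
    (supp_cont (hcpt i)).sub ((supp_cont (hcpt _)).max (supp_cont (hcpt _)))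
  have F0 : 0 ≤ F (t0 + Real.pi) := by
    simp only [F]
    exact sub_nonneg.2 (max_le (hi _) (hi _))
  -- a zero of F in the open interval suffices
  suffices h : ∃ t ∈ Set.Ioo t0 (t0 + 2 * Real.pi), F t = 0 by
    obtain ⟨t, ht, hF⟩ := h
    have hF : supp (K i) t = max (supp (K (i+1)) t) (supp (K (i+2)) t) := sub_eq_zero.1 hF
    have hk : ∀ k, supp (K k) t ≤ supp (K i) t := by
      intro k
      rcases hall k with rfl | rfl | rfl
      · exact le_rfl
      · rw [hF]; exact le_max_left _ _
      · rw [hF]; exact le_max_right _ _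
    rcases max_choice (supp (K (i+1)) t) (supp (K (i+2)) t) with h | h
    · exact ⟨t, ht, i, i + 1, hij, hF.trans h, hk⟩
    · exact ⟨t, ht, i, i + 2, hik, hF.trans h, hk⟩
  -- a negative value of F
  obtain ⟨s, hs⟩ := not_dominated (hcpt i) (hcpt (i+1)) (hcv i) (hdisj hij) (hne _) (hne _)
  have Fs : F s < 0 := by
    simp only [F]
    have := le_max_left (supp (K (i+1)) s) (supp (K (i+2)) s)
    linarith
  have FP : Function.Periodic F (2 * Real.pi) := by
    intro t
    simp only [F, supp_period _ t]
  obtain ⟨y, hy, hFy⟩ := FP.exists_mem_Ico (by positivity) s t0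
  rw [hFy] at Fs
  -- move into the open interval
  obtain ⟨z, hz, Fz⟩ : ∃ z ∈ Set.Ioo t0 (t0 + 2 * Real.pi), F z < 0 := by
    rcases hy.1.lt_or_eq with h | h
    · exact ⟨y, ⟨h, hy.2⟩, Fs⟩
    · subst h
      have h1 : ∀ᶠ z in nhdsWithin t0 (Set.Ioi t0), F z < 0 :=
        nhdsWithin_le_nhds (Fc.continuousAt.eventually_lt continuousAt_const Fs)
      have h2 : Set.Ioo t0 (t0 + 2 * Real.pi) ∈ nhdsWithin t0 (Set.Ioi t0) :=
        Ioo_mem_nhdsGT (by linarith)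
      obtain ⟨z, hz1, hz2⟩ := (h1.and h2).exists
      exact ⟨z, hz2, hz1⟩
  have hp : t0 + Real.pi ∈ Set.Ioo t0 (t0 + 2 * Real.pi) := ⟨by linarith, by linarith⟩
  obtain ⟨t, ht, h⟩ := isPreconnected_Ioo.intermediate_value hz hp Fc.continuousOn
    (show (0:ℝ) ∈ Set.Icc (F z) (F (t0 + Real.pi)) from ⟨Fz.le, F0⟩)
  exact ⟨t, ht, h⟩

lemma case_three (K : Fin 3 → Set Pl) (hdisj : Pairwise fun i j => Disjoint (K i) (K j))
    (hcpt : ∀ i, IsCompact (K i)) (hsc : ∀ i, StrictConvex ℝ (K i))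
    (hint : ∀ i, (interior (K i)).Nonempty) :
    ∃ L : AffineSubspace ℝ Pl, Module.finrank ℝ L.direction = 1 ∧
      ∃ p q, p ≠ q ∧ (L : Set Pl) ∩ (⋃ i, K i) = {p, q} := by
  by_contra hno
  have hne : ∀ i, (K i).Nonempty := fun i => (hint i).mono interior_subset
  have triple : ∀ t0, ∃ t ∈ Set.Ioo t0 (t0 + 2 * Real.pi), ∃ c, (∀ i, ∀ x ∈ K i, ev t x ≤ c) ∧
      ∀ i, ∃ x ∈ K i, ev t x = c := by
    intro t0
    obtain ⟨t, ht, i, j, hij, e, hm⟩ := tie K hdisj hcpt (fun i => (hsc i).convex) hne t0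
    have hle : ∀ k, ∀ x ∈ K k, ev t x ≤ supp (K i) t := fun k x hx =>
      (supp_le (hcpt k) t hx).trans (hm k)
    refine ⟨t, ht, supp (K i) t, hle, fun k => ?_⟩
    obtain ⟨a, ha, ea⟩ := supp_att (hcpt i) (hne i) t
    obtain ⟨b, hb, eb⟩ := supp_att (hcpt j) (hne j) t
    rw [← e] at eb
    by_contra hk
    push Not at hk
    refine hno (mk_line K (hdisj hij) ha hb ea eb
      (fun x hx ex => max_uniq (hsc i) (hle i) hx ha ex ea)
      (fun x hx ex => max_uniq (hsc j) (hle j) hx hb ex eb) ?_)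
    intro k' h1 h2 x hx
    have : k' = k := by
      have hki : k ≠ i := by rintro rfl; exact hk a ha ea
      have hkj : k ≠ j := by rintro rfl; exact hk b hb eb
      omega
    subst this
    exact hk x hx
  obtain ⟨t, -, c, hb, hp⟩ := triple 0
  obtain ⟨t', ht', c', hb', hq⟩ := triple t
  choose p hpK hp using hp
  choose q hqK hq using hq
  have htt : ¬ (Real.cos t = Real.cos t' ∧ Real.sin t = Real.sin t') := by
    rintro ⟨h1, h2⟩
    have : Real.cos (t' - t) = 1 := by
      rw [Real.cos_sub, ← h1, ← h2]
      linear_combination Real.cos_sq_add_sin_sq t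
    have h3 := (Real.cos_eq_one_iff_of_lt_of_lt (x := t' - t)
      (by linarith [ht'.1, Real.pi_pos]) (by linarith [ht'.2])).1 this
    linarith [ht'.1]
  have key : ∀ i j k : Fin 3, i ≠ j → i ≠ k → j ≠ k → Wbtw ℝ (p i) (p j) (p k) → False := by
    intro i j k hij hik hjk hw
    obtain ⟨s, d, f1, f2, ⟨a, ha, ea⟩, ⟨b, hb, eb⟩, hr⟩ := core (hcpt i) (hcpt j) (hsc i) (hsc j)
      (hsc k) (hint i) (hint j) (hdisj hij) (hdisj hik) (hdisj hjk) htt (hb i) (hb j) (hb k)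
      (hb' i) (hb' j) (hb' k) (hpK i) (hpK j) (hpK k) (hqK j) (hp i) (hp j) (hp k) (hq j) hw
    refine hno (mk_line K (hdisj hij) ha hb ea eb
      (fun x hx ex => max_uniq (hsc i) f1 hx ha ex ea)
      (fun x hx ex => min_uniq (hsc j) f2 hx hb ex eb) ?_)
    intro k' h1 h2
    have : k' = k := by omega
    subst this
    exact hr
  have hcol : Collinear ℝ {p 0, p 1, p 2} := by
    obtain ⟨L, hL, hm⟩ := line_exists t (p 0)
    have h1 : Collinear ℝ (L : Set Pl) := by
      rw [collinear_iff_finrank_le_one, ← direction_affineSpan, AffineSubspace.affineSpan_coe, hL]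
    refine h1.subset ?_
    rintro x (rfl | rfl | rfl)
    · exact (hm _).2 rfl
    · exact (hm _).2 ((hp _).trans (hp _).symm)
    · exact (hm _).2 ((hp _).trans (hp _).symm)
  rcases hcol.wbtw_or_wbtw_or_wbtw with h | h | h
  · exact key 0 1 2 (by decide) (by decide) (by decide) h
  · exact key 1 2 0 (by decide) (by decide) (by decide) h
  · exact key 2 0 1 (by decide) (by decide) (by decide) h

theorem convex_system_plane_small (n : ℕ) (hn : n = 2 ∨ n = 3)
    (K : Fin n → Set (EuclideanSpace ℝ (Fin 2)))
    (hdisj : Pairwise fun i j => Disjoint (K i) (K j))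
    (hcpt : ∀ i, IsCompact (K i))
    (hsc : ∀ i, StrictConvex ℝ (K i))
    (hint : ∀ i, (interior (K i)).Nonempty) :
    ∃ L : AffineSubspace ℝ (EuclideanSpace ℝ (Fin 2)), IsLine L ∧
      ∃ p q, p ≠ q ∧ (L : Set (EuclideanSpace ℝ (Fin 2))) ∩ (⋃ i, K i) = {p, q} := by
  unfold IsLine
  rcases hn with rfl | rfl
  · have hne : ∀ i, (K i).Nonempty := fun i => (hint i).mono interior_subset
    have h01 : (0 : Fin 2) ≠ 1 := by decide
    obtain ⟨s, d, f1, f2, ⟨a, ha, ea⟩, ⟨b, hb, eb⟩⟩ := inner_tangent (hcpt 0) (hcpt 1)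
      (hsc 0).convex (hsc 1).convex (hdisj h01) (hne 0) (hne 1)
    refine mk_line K (hdisj h01) ha hb ea eb
      (fun x hx ex => max_uniq (hsc 0) f1 hx ha ex ea)
      (fun x hx ex => min_uniq (hsc 1) f2 hx hb ex eb) ?_
    intro k h1 h2
    omega
  · exact case_three K hdisj hcpt hsc hint
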